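/- arXiv:1307.3532 — 2 statements merged into one kernel-verified Lean document; each statement's English description precedes it below -/
import Mathlib

section
/- Let d > 0, f ∈ ℛ_d, and let f = g_1 + … + g_n be a regular splitting of f. Then the Hilbert function of R/ann_R f satisfies dim_K (R/ann_R f)_e = Σ_{i=1}^n dim_K (R/ann_R g_i)_e for all 0 < e < d, while dim_K (R/ann_R f)_0 = dim_K (R/ann_R f)_d = 1; that is, H(R/ann_R f) = Σ_{i=1}^n H(R/ann_R g_i) − (n−1)(δ_0 + δ_d), where δ_e denotes the function that is 1 in degree e and 0 elsewhere. -/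
open MvPolynomial

namespace Kleppe

noncomputable section

open scoped Classical

variable {K : Type*}

/-- The iterated partial-derivative operator `∂^β` applied to `f`
(in the standard polynomial ring; char 0 identification of divided powers). -/
def derivMulti [CommSemiring K] {r : ℕ} (β : Fin r →₀ ℕ) (f : MvPolynomial (Fin r) K) :
    MvPolynomial (Fin r) K :=
  ∑ α ∈ f.support,
    if β ≤ α then
      MvPolynomial.monomial (α - β)
        ((∏ i : Fin r, (α i).descFactorial (β i)) • MvPolynomial.coeff α f)
    else 0

/-- The apolarity action `D(f)` of a differential operator `D ∈ R = K[∂_1,…,∂_r]`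
on a polynomial `f ∈ ℛ = K[x_1,…,x_r]`; `∂_i` acts as `∂/∂x_i`. -/
def contract [CommSemiring K] {r : ℕ} (D f : MvPolynomial (Fin r) K) :
    MvPolynomial (Fin r) K :=
  ∑ β ∈ D.support, MvPolynomial.coeff β D • derivMulti β f

/-- `(A∂)_i = Σ_k A_{ik} ∂_k`, as an element of `R`. -/
def rowOp [CommSemiring K] {r : ℕ} (A : Matrix (Fin r) (Fin r) K) (i : Fin r) :
    MvPolynomial (Fin r) K :=
  ∑ k : Fin r, A i k • X k

/-- The matrix space `M_f = {A | ∂_i·(A∂)_j − ∂_j·(A∂)_i ∈ ann_R f for all i,j}`. -/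
def Mf [CommRing K] {r : ℕ} (f : MvPolynomial (Fin r) K) :
    Set (Matrix (Fin r) (Fin r) K) :=
  {A | ∀ i j : Fin r, contract (X i * rowOp A j - X j * rowOp A i) f = 0}

/-- `γ_f(A)`: the unique homogeneous `g` of degree `d` with `∂_i g = (A∂)_i (f)` for all `i`
(defined by choice; junk value `0` if no such `g` exists). -/
def gammaf [CommRing K] {r : ℕ} (d : ℕ) (f : MvPolynomial (Fin r) K)
    (A : Matrix (Fin r) (Fin r) K) : MvPolynomial (Fin r) K :=
  if h : ∃ g : MvPolynomial (Fin r) K, g.IsHomogeneous d ∧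
      ∀ i, contract (X i) g = contract (rowOp A i) f then h.choose else 0

/-- `R_e(g)`, the space of contractions of `g` by homogeneous operators of degree `e`. -/
def partials [CommRing K] {r : ℕ} (e : ℕ) (g : MvPolynomial (Fin r) K) :
    Submodule K (MvPolynomial (Fin r) K) :=
  Submodule.span K {p | ∃ D : MvPolynomial (Fin r) K, D.IsHomogeneous e ∧ p = contract D g}

/-- `G` is (the set of components of) a regular splitting of `f`:
`f = Σ_{g ∈ G} g`, each `g` a nonzero degree-`d` form, and the spaces of
`(d−1)`-st partials `R_{d−1}(g)` are independent. -/
def IsRegSplit [CommRing K] {r : ℕ} (d : ℕ) (f : MvPolynomial (Fin r) K)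
    (G : Set (MvPolynomial (Fin r) K)) : Prop :=
  G.Finite ∧ G.Nonempty ∧ (∀ g ∈ G, g ≠ 0 ∧ g.IsHomogeneous d) ∧ (∑ᶠ g ∈ G, g) = f ∧
  ∀ g ∈ G, Disjoint (partials (d - 1) g) (⨆ h ∈ G \ {g}, partials (d - 1) h)

/-- A complete set of orthogonal idempotents in `M_f`. -/
def IsCoid [CommRing K] {r : ℕ} (f : MvPolynomial (Fin r) K)
    (E : Set (Matrix (Fin r) (Fin r) K)) : Prop :=
  E.Finite ∧ E ⊆ Mf f ∧ (∀ A ∈ E, A ≠ 0) ∧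
  (∀ A ∈ E, ∀ B ∈ E, A ≠ B → A * B = 0) ∧ (∑ᶠ A ∈ E, A) = 1

end

/-- The Hilbert function of `R/ann_R f` in degree `e`:
`dim_K (R/ann_R f)_e = dim_K R_e − dim_K ann_R(f)_e`. -/
noncomputable def hilb {K : Type*} [Field K] {r : ℕ} (f : MvPolynomial (Fin r) K) (e : ℕ) : ℕ :=
  Set.finrank K {D : MvPolynomial (Fin r) K | D.IsHomogeneous e} -
  Set.finrank K {D : MvPolynomial (Fin r) K | D.IsHomogeneous e ∧ contract D f = 0}


section helpers

open Module

lemma finrank_pi_aux {K U ι : Type*} [Field K] [AddCommGroup U] [Module K U]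
    [FiniteDimensional K U] [Fintype ι] (p : ι → Submodule K U) :
    finrank K (∀ i, p i) = ∑ i, finrank K (p i) :=
  Module.finrank_pi_fintype K

lemma rank_sum_aux {K V W ι : Type*} [Field K] [AddCommGroup V] [Module K V] [AddCommGroup W]
    [Module K W] [FiniteDimensional K V] [FiniteDimensional K W] [Fintype ι]
    (B : ι → V →ₗ[K] W →ₗ[K] K)
    (h1 : ∀ v : ι → V, (∀ w, ∑ i, B i (v i) w = 0) → ∀ i w, B i (v i) w = 0)
    (h2 : ∀ w : W, (∀ v, ∑ i, B i v w = 0) → ∀ i v, B i v w = 0)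
    (B' : V →ₗ[K] W →ₗ[K] K) (hB' : ∀ v w, B' v w = ∑ i, B i v w) :
    finrank K (LinearMap.range B') = ∑ i, finrank K (LinearMap.range (B i)) := by
  classical
  have key : ∀ i, LinearMap.range (B i) ≤ LinearMap.range B' := by
    intro i
    have e1 := LinearMap.dualAnnihilator_ker_eq_range_flip (B := (B i).flip)
    have e2 := LinearMap.dualAnnihilator_ker_eq_range_flip (B := B'.flip)
    rw [LinearMap.flip_flip] at e1 e2
    rw [← e1, ← e2]
    apply Submodule.dualAnnihilator_anti
    intro w hw
    rw [LinearMap.mem_ker] at hw ⊢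
    ext v
    refine h2 w (fun v => ?_) i v
    rw [← hB']
    exact LinearMap.congr_fun hw v
  let T : (∀ i, LinearMap.range (B i)) →ₗ[K] (W →ₗ[K] K) :=
    ∑ i, (LinearMap.range (B i)).subtype ∘ₗ LinearMap.proj i
  have hT : ∀ x, T x = ∑ i, (x i : W →ₗ[K] K) := by
    intro x
    simp [T]
  have hinj : Function.Injective T := by
    rw [injective_iff_map_eq_zero]
    intro x hx
    choose v hv using fun i => (x i).2
    rw [hT] at hx
    have h3 := h1 v (fun w => by
      have := LinearMap.congr_fun hx w
      simpa [hv, LinearMap.sum_apply] using this)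
    funext i
    apply Subtype.ext
    rw [← hv i]
    ext w
    simpa using h3 i w
  have hran : LinearMap.range T = LinearMap.range B' := by
    apply le_antisymm
    · rintro _ ⟨x, rfl⟩
      rw [hT]
      exact Submodule.sum_mem _ fun i _ => key i (x i).2
    · rintro _ ⟨v, rfl⟩
      refine ⟨fun i => ⟨B i v, v, rfl⟩, ?_⟩
      rw [hT]
      ext w
      simp [hB', LinearMap.sum_apply]
  rw [← hran, LinearMap.finrank_range_of_inj hinj]
  exact finrank_pi_aux (fun i => LinearMap.range (B i))

/-- multi-factorial -/
noncomputable def mfac {r : ℕ} (α : Fin r →₀ ℕ) : ℕ := ∏ i, (α i).factorial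

lemma mfac_ne {r : ℕ} (α : Fin r →₀ ℕ) : mfac α ≠ 0 :=
  Finset.prod_ne_zero_iff.2 fun i _ => Nat.factorial_ne_zero _

noncomputable def phi {K : Type*} [Field K] {r : ℕ} (g : MvPolynomial (Fin r) K) :
    MvPolynomial (Fin r) K →ₗ[K] K :=
  (basisMonomials (Fin r) K).constr K (fun α => (mfac α : K) * coeff α g)

lemma phi_monomial {K : Type*} [Field K] {r : ℕ} (g : MvPolynomial (Fin r) K)
    (α : Fin r →₀ ℕ) (c : K) : phi g (monomial α c) = c * ((mfac α : K) * coeff α g) := by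
  have : monomial α c = c • (basisMonomials (Fin r) K) α := by
    simp [smul_monomial]
  rw [this, map_smul, phi, Module.Basis.constr_basis, smul_eq_mul]

lemma phi_sum {K : Type*} [Field K] {r : ℕ} {ι : Type*} (s : Finset ι)
    (g : ι → MvPolynomial (Fin r) K) (P : MvPolynomial (Fin r) K) :
    phi (∑ i ∈ s, g i) P = ∑ i ∈ s, phi (g i) P := by
  induction P using MvPolynomial.induction_on' with
  | monomial α c => simp [phi_monomial, coeff_sum, Finset.mul_sum]
  | add p q hp hq => simp [hp, hq, Finset.sum_add_distrib]

lemma phi_eq_sum {K : Type*} [Field K] {r : ℕ} (g P : MvPolynomial (Fin r) K) :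
    phi g P = ∑ β ∈ P.support, coeff β P * ((mfac β : K) * coeff β g) := by
  conv_lhs => rw [P.as_sum, map_sum]
  simp [phi_monomial]

lemma phi_homog {K : Type*} [Field K] {r d m : ℕ} {g P : MvPolynomial (Fin r) K}
    (hg : g.IsHomogeneous d) (hP : P.IsHomogeneous m) (h : m ≠ d) : phi g P = 0 := by
  rw [phi_eq_sum]
  refine Finset.sum_eq_zero fun β hβ => ?_
  have := hP.degree_eq_sum_deg_support hβ
  rw [hg.coeff_eq_zero (d := β), mul_zero, mul_zero]
  intro h'
  apply h
  rw [← h', this]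
  rfl

lemma coeff_derivMulti {K : Type*} [Field K] {r : ℕ} (β γ : Fin r →₀ ℕ)
    (g : MvPolynomial (Fin r) K) :
    (mfac γ : K) * coeff γ (derivMulti β g) = (mfac (γ + β) : K) * coeff (γ + β) g := by
  have h : coeff γ (derivMulti β g)
      = ((∏ i : Fin r, ((γ + β) i).descFactorial (β i) : ℕ) : K) * coeff (γ + β) g := by
    classical
    unfold derivMulti
    rw [coeff_sum, Finset.sum_eq_single (γ + β)]
    · rw [if_pos (le_add_of_nonneg_left zero_le), add_tsub_cancel_right, coeff_monomial,
        if_pos rfl, nsmul_eq_mul]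
    · intro α _ hα
      split_ifs with hle
      · rw [coeff_monomial, if_neg]
        rintro rfl
        exact hα (tsub_add_cancel_of_le hle).symm
      · simp
    · intro hn
      rw [notMem_support_iff.1 hn]
      simp
  rw [h, ← mul_assoc, ← Nat.cast_mul]
  congr 2
  unfold mfac
  rw [← Finset.prod_mul_distrib]
  refine Finset.prod_congr rfl fun i _ => ?_
  have := Nat.factorial_mul_descFactorial (n := (γ + β) i) (k := β i) (by simp)
  simpa using this

lemma phi_mul_monomial {K : Type*} [Field K] {r : ℕ} (D g : MvPolynomial (Fin r) K)
    (γ : Fin r →₀ ℕ) :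
    phi g (D * monomial γ 1) = (mfac γ : K) * coeff γ (contract D g) := by
  unfold contract
  rw [coeff_sum, Finset.mul_sum]
  conv_lhs => rw [D.as_sum, Finset.sum_mul, map_sum]
  refine Finset.sum_congr rfl fun β _ => ?_
  rw [monomial_mul, phi_monomial, coeff_smul, smul_eq_mul, mul_left_comm (mfac γ : K), coeff_derivMulti,
    add_comm β γ, mul_one]

lemma contract_zero_iff {K : Type*} [Field K] [CharZero K] {r : ℕ}
    (D g : MvPolynomial (Fin r) K) :
    contract D g = 0 ↔ ∀ Q, phi g (D * Q) = 0 := by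
  constructor
  · intro h Q
    induction Q using MvPolynomial.induction_on' with
    | monomial α c =>
      have : monomial α c = c • (monomial α (1 : K)) := by simp [smul_monomial]
      rw [this, mul_smul_comm, map_smul, phi_mul_monomial, h]
      simp
    | add p q hp hq => rw [mul_add, map_add, hp, hq, add_zero]
  · intro h
    ext γ
    have := h (monomial γ 1)
    rw [phi_mul_monomial] at this
    simpa [mfac_ne] using this

lemma contract_zero_iff' {K : Type*} [Field K] [CharZero K] {r e k d : ℕ}
    {D g : MvPolynomial (Fin r) K} (hg : g.IsHomogeneous d) (hD : D.IsHomogeneous e)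
    (hek : e + k = d) :
    contract D g = 0 ↔ ∀ Q : MvPolynomial (Fin r) K, Q.IsHomogeneous k → phi g (D * Q) = 0 := by
  rw [contract_zero_iff]
  refine ⟨fun h Q _ => h Q, fun h Q => ?_⟩
  induction Q using MvPolynomial.induction_on' with
  | monomial α c =>
    by_cases hα : α.degree = k
    · exact h _ (isHomogeneous_monomial c hα)
    · exact phi_homog hg (hD.mul (isHomogeneous_monomial c rfl)) (by omega)
  | add p q hp hq => rw [mul_add, map_add, hp, hq, add_zero]

lemma contract_eq_of_sum_zero {K : Type*} [Field K] [CharZero K] {r : ℕ} {ι : Type*}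
    (s : Finset ι) (D g : ι → MvPolynomial (Fin r) K)
    (h : ∀ Q, ∑ i ∈ s, phi (g i) (D i * Q) = 0) : ∑ i ∈ s, contract (D i) (g i) = 0 := by
  ext γ
  have := h (monomial γ 1)
  simp only [phi_mul_monomial, ← Finset.mul_sum] at this
  rw [coeff_sum]
  simpa [mfac_ne] using this

lemma split_indep {K : Type*} [Field K] {r d : ℕ} {f : MvPolynomial (Fin r) K}
    {G : Set (MvPolynomial (Fin r) K)} (hG : IsRegSplit d f G) [Fintype G]
    (D : G → MvPolynomial (Fin r) K) (hD : ∀ i, (D i).IsHomogeneous (d - 1))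
    (h : ∑ i, contract (D i) i.1 = 0) (i : G) : contract (D i) i.1 = 0 := by
  classical
  have hdis := hG.2.2.2.2 i.1 i.2
  have hm : ∀ j : G, contract (D j) j.1 ∈ partials (d - 1) j.1 := fun j =>
    Submodule.subset_span ⟨D j, hD j, rfl⟩
  refine Submodule.disjoint_def.1 hdis _ (hm i) ?_
  rw [← Finset.add_sum_erase _ _ (Finset.mem_univ i)] at h
  rw [eq_neg_of_add_eq_zero_left h]
  refine Submodule.neg_mem _ (Submodule.sum_mem _ fun j hj => ?_)
  have hj' : j.1 ∈ G \ {i.1} := ⟨j.2, fun h' => (Finset.mem_erase.1 hj).1 (Subtype.ext h')⟩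
  exact (le_iSup₂_of_le (f := fun h (_ : h ∈ G \ {i.1}) => partials (d - 1) h) j.1 hj' le_rfl) (hm j)

lemma split_indep' {K : Type*} [Field K] [CharZero K] {r d e k : ℕ} {f : MvPolynomial (Fin r) K}
    {G : Set (MvPolynomial (Fin r) K)} (hG : IsRegSplit d f G) [Fintype G]
    (hek : e + (k + 1) = d)
    (D : G → MvPolynomial (Fin r) K) (hD : ∀ i, (D i).IsHomogeneous e)
    (h : ∀ Q : MvPolynomial (Fin r) K, Q.IsHomogeneous (k + 1) → ∑ i, phi i.1 (D i * Q) = 0)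
    (i : G) (Q : MvPolynomial (Fin r) K) : phi i.1 (D i * Q) = 0 := by
  have hgh : ∀ i : G, i.1.IsHomogeneous d := fun i => (hG.2.2.1 i.1 i.2).2
  have hall : ∀ Q, ∑ i, phi i.1 (D i * Q) = 0 := by
    intro Q
    induction Q using MvPolynomial.induction_on' with
    | monomial α c =>
      by_cases hα : α.degree = k + 1
      · exact h _ (isHomogeneous_monomial c hα)
      · exact Finset.sum_eq_zero fun i _ =>
          phi_homog (hgh i) ((hD i).mul (isHomogeneous_monomial c rfl)) (by omega)
    | add p q hp hq => simp only [mul_add, map_add, Finset.sum_add_distrib, hp, hq, add_zero]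
  induction Q using MvPolynomial.induction_on' with
  | add p q hp hq => rw [mul_add, map_add, hp, hq, add_zero]
  | monomial α c =>
    by_cases hα : α.degree = k + 1
    · obtain ⟨j, hj⟩ : ∃ j, α j ≠ 0 := by
        by_contra! hc
        have : α = 0 := by ext j; simpa using hc j
        simp [this] at hα
      have hle : Finsupp.single j 1 ≤ α := by
        simpa using Nat.one_le_iff_ne_zero.2 hj
      have hsplit : α - Finsupp.single j 1 + Finsupp.single j 1 = α := tsub_add_cancel_of_le hle
      have hdeg : (α - Finsupp.single j 1).degree = k := by
        have := congrArg Finsupp.degree hsplit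
        rw [map_add, hα, Finsupp.degree_single] at this
        omega
      have hmon : monomial α c = monomial (α - Finsupp.single j 1) c *
          monomial (Finsupp.single j 1) (1 : K) := by
        rw [monomial_mul, hsplit, mul_one]
      have hz := split_indep hG (fun i => D i * monomial (α - Finsupp.single j 1) c)
        (fun i => by
          have := (hD i).mul (isHomogeneous_monomial c hdeg)
          rwa [show e + k = d - 1 by omega] at this)
        (contract_eq_of_sum_zero _ _ _ fun Q => by
          simpa only [mul_assoc] using hall _) i
      rw [hmon, ← mul_assoc]
      exact (contract_zero_iff _ _).1 hz _
    · exact phi_homog (hgh i) ((hD i).mul (isHomogeneous_monomial c rfl)) (by omega)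

/-- the pairing -/
noncomputable def pairing {K : Type*} [Field K] {r : ℕ} (g : MvPolynomial (Fin r) K) (e k : ℕ) :
    homogeneousSubmodule (Fin r) K e →ₗ[K] homogeneousSubmodule (Fin r) K k →ₗ[K] K :=
  (((LinearMap.mul K (MvPolynomial (Fin r) K)).compr₂ (phi g)).domRestrict₁₂ _ _)

lemma pairing_apply {K : Type*} [Field K] {r : ℕ} (g : MvPolynomial (Fin r) K) (e k : ℕ)
    (D : homogeneousSubmodule (Fin r) K e) (Q : homogeneousSubmodule (Fin r) K k) :
    pairing g e k D Q = phi g (D.1 * Q.1) := rfl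

instance fin_homog {K : Type*} [Field K] {r : ℕ} (e : ℕ) :
    Module.Finite K (homogeneousSubmodule (Fin r) K e) :=
  Module.Finite.iff_fg.2 (homogeneousSubmodule_fg _ _ e)

lemma hilb_eq {K : Type*} [Field K] [CharZero K] {r d e k : ℕ} {g : MvPolynomial (Fin r) K}
    (hg : g.IsHomogeneous d) (hek : e + k = d) :
    hilb g e = finrank K (LinearMap.range (pairing g e k)) := by
  have h1 : Set.finrank K {D : MvPolynomial (Fin r) K | D.IsHomogeneous e}
      = finrank K (homogeneousSubmodule (Fin r) K e) := by
    unfold Set.finrank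
    have : {D : MvPolynomial (Fin r) K | D.IsHomogeneous e}
      = (homogeneousSubmodule (Fin r) K e : Set _) := rfl
    rw [this, Submodule.span_eq]
  have h2 : Set.finrank K {D : MvPolynomial (Fin r) K | D.IsHomogeneous e ∧ contract D g = 0}
      = finrank K (LinearMap.ker (pairing g e k)) := by
    unfold Set.finrank
    have : {D : MvPolynomial (Fin r) K | D.IsHomogeneous e ∧ contract D g = 0}
      = ((LinearMap.ker (pairing g e k)).map (homogeneousSubmodule (Fin r) K e).subtype :
        Set (MvPolynomial (Fin r) K)) := by
      ext D
      simp only [Set.mem_ofPred_eq, SetLike.mem_coe, Submodule.mem_map, LinearMap.mem_ker]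
      constructor
      · rintro ⟨hD, hc⟩
        refine ⟨⟨D, hD⟩, ?_, rfl⟩
        ext Q
        exact (contract_zero_iff _ _).1 hc Q
      · rintro ⟨D, hD, rfl⟩
        refine ⟨D.2, (contract_zero_iff' hg D.2 hek).2 fun Q hQ => ?_⟩
        exact LinearMap.congr_fun hD ⟨Q, hQ⟩
    rw [this, Submodule.span_eq]
    exact Submodule.finrank_map_subtype_eq _ _
  unfold hilb
  rw [h1, h2, ← LinearMap.finrank_range_add_finrank_ker (pairing g e k)]
  omega

end helpers

/-- Lemma 3.36e. If `f = g_1 + … + g_n` is a regular splitting of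
`f ∈ ℛ_d`, `d > 0`, then `H(R/ann_R f)(e) = Σ_i H(R/ann_R g_i)(e)` for `0 < e < d`,
and `H(R/ann_R f)(0) = H(R/ann_R f)(d) = 1`. -/
theorem hilbert_function_of_regsplit {K : Type*} [Field K] [CharZero K] {r d : ℕ}
    (hd : 0 < d) (f : MvPolynomial (Fin r) K) (hf : f.IsHomogeneous d)
    (G : Set (MvPolynomial (Fin r) K)) (hG : IsRegSplit d f G) :
    (∀ e, 0 < e → e < d → hilb f e = ∑ᶠ g ∈ G, hilb g e) ∧
    hilb f 0 = 1 ∧ hilb f d = 1 := by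
  classical
  have hfin := hG.1
  letI : Fintype G := hfin.fintype
  have hgh : ∀ i : G, i.1.IsHomogeneous d := fun i => (hG.2.2.1 i.1 i.2).2
  have hsum : ∑ i : G, i.1 = f := by
    rw [← hG.2.2.2.1, finsum_mem_eq_finite_toFinset_sum _ hfin]
    exact (Finset.sum_subtype (p := (· ∈ G)) hfin.toFinset (by simp) (fun g => g)).symm
  have hphi : ∀ P, phi f P = ∑ i : G, phi i.1 P := by
    intro P
    rw [← phi_sum, hsum]
  have hone : ∀ g : MvPolynomial (Fin r) K, (∀ Q, phi g (1 * Q) = 0) → g = 0 := by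
    intro g h
    ext γ
    have := h (monomial γ 1)
    rw [one_mul, phi_monomial] at this
    simpa [mfac_ne] using this
  have hf0 : f ≠ 0 := by
    intro h0
    obtain ⟨g, hg⟩ := hG.2.1
    refine (hG.2.2.1 g hg).1 (hone g fun Q => ?_)
    refine split_indep' hG (e := 0) (k := d - 1) (by omega) (fun _ => 1)
      (fun _ => isHomogeneous_one _ _) (fun Q _ => ?_) ⟨g, hg⟩ Q
    simp only [one_mul]
    rw [← hphi, h0]
    simp [phi_eq_sum]
  have hpos : ∃ Q : MvPolynomial (Fin r) K, Q.IsHomogeneous d ∧ phi f Q ≠ 0 := by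
    by_contra! hc
    refine hf0 (hone f fun Q => ?_)
    refine (contract_zero_iff _ _).1 ?_ Q
    rw [contract_zero_iff' hf (isHomogeneous_one _ _) (zero_add d)]
    intro Q hQ
    rw [one_mul]
    exact hc Q hQ
  obtain ⟨Q, hQ, hQ0⟩ := hpos
  have hR0 : Module.finrank K (homogeneousSubmodule (Fin r) K 0) = 1 := by
    rw [homogeneousSubmodule_zero, Submodule.one_eq_span]
    exact finrank_span_singleton one_ne_zero
  refine ⟨fun e he hed => ?_, ?_, ?_⟩
  · obtain ⟨k, hk⟩ : ∃ k, e + (k + 1) = d := ⟨d - e - 1, by omega⟩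
    obtain ⟨e', rfl⟩ : ∃ e', e = e' + 1 := ⟨e - 1, by omega⟩
    rw [hilb_eq hf hk, finsum_mem_eq_finite_toFinset_sum _ hfin,
      Finset.sum_subtype (p := (· ∈ G)) _ (by simp),
      rank_sum_aux (fun i : G => pairing i.1 (e' + 1) (k + 1))]
    · exact Finset.sum_congr rfl fun i _ => (hilb_eq (hgh i) hk).symm
    · intro v hv i w
      exact split_indep' hG hk (fun i => (v i).1) (fun i => (v i).2)
        (fun Q hQ => hv ⟨Q, hQ⟩) i w.1
    · intro w hw i v
      rw [pairing_apply, mul_comm]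
      refine split_indep' hG (e := k + 1) (k := e') (by omega) (fun i => w.1) (fun i => w.2)
        (fun Q hQ => ?_) i v.1
      simp only [mul_comm w.1]
      exact hw ⟨Q, hQ⟩
    · intro v w
      exact hphi _
  · rw [hilb_eq hf (zero_add d)]
    apply le_antisymm
    · exact (LinearMap.finrank_range_le _).trans hR0.le
    · rw [Nat.one_le_iff_ne_zero, ne_eq, Submodule.finrank_eq_zero, LinearMap.range_eq_bot]
      intro h
      apply hQ0
      have := LinearMap.congr_fun (LinearMap.congr_fun h ⟨1, isHomogeneous_one _ _⟩) ⟨Q, hQ⟩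
      rwa [pairing_apply, one_mul] at this
  · rw [hilb_eq hf (add_zero d)]
    apply le_antisymm
    · refine (Submodule.finrank_le _).trans ?_
      exact (Subspace.dual_finrank_eq.trans hR0).le
    · rw [Nat.one_le_iff_ne_zero, ne_eq, Submodule.finrank_eq_zero, LinearMap.range_eq_bot]
      intro h
      apply hQ0
      have := LinearMap.congr_fun (LinearMap.congr_fun h ⟨Q, hQ⟩) ⟨1, isHomogeneous_one _ _⟩
      rwa [pairing_apply, mul_one] at this

end Kleppe
end

section
/- Let d ≥ 0 and f_t ∈ ℛ_d ⊗_K K[t_1,…,t_n], and let f_0 denote its evaluation at t_1 = … = t_n = 0. Then dim_{K(t_1,…,t_n)} M_{f_t} ≤ dim_K M_{f_0}, where M_{f_t} is computed over the field K(t_1,…,t_n). In particular, if f_t splits regularly m times over K(t_1,…,t_n), then m ≤ dim_K M_{f_0} − 1. -/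
open MvPolynomial

namespace Kleppe

section Helpers

open scoped Classical

theorem derivMulti_eq {K : Type*} [CommSemiring K] {r : ℕ} (β : Fin r →₀ ℕ)
    (f : MvPolynomial (Fin r) K) (s : Finset (Fin r →₀ ℕ)) (hs : f.support ⊆ s) :
    derivMulti β f = ∑ α ∈ s, MvPolynomial.monomial (α - β)
        ((∏ i : Fin r, (α i).descFactorial (β i)) • MvPolynomial.coeff α f) := by
  unfold derivMulti
  rw [← Finset.sum_subset hs]
  · refine Finset.sum_congr rfl fun α _ => ?_
    split_ifs with h
    · rfl
    · have : ∃ i, α i < β i := by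
        by_contra! hc
        exact h hc
      obtain ⟨i, hi⟩ := this
      rw [Finset.prod_eq_zero (Finset.mem_univ i) (Nat.descFactorial_eq_zero_iff_lt.2 hi)]
      simp
  · intro α _ h
    rw [MvPolynomial.notMem_support_iff.1 h]
    simp

theorem derivMulti_add {K : Type*} [CommSemiring K] {r : ℕ} (β : Fin r →₀ ℕ)
    (f g : MvPolynomial (Fin r) K) :
    derivMulti β (f + g) = derivMulti β f + derivMulti β g := by
  rw [derivMulti_eq β (f + g) (f.support ∪ g.support) MvPolynomial.support_add,
    derivMulti_eq β f (f.support ∪ g.support) Finset.subset_union_left,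
    derivMulti_eq β g (f.support ∪ g.support) Finset.subset_union_right, ← Finset.sum_add_distrib]
  refine Finset.sum_congr rfl fun α _ => ?_
  rw [coeff_add, smul_add, map_add]

theorem derivMulti_monomial {K : Type*} [CommSemiring K] {r : ℕ} (β α : Fin r →₀ ℕ) (c : K) :
    derivMulti β (monomial α c) =
      monomial (α - β) ((∏ i : Fin r, (α i).descFactorial (β i)) • c) := by
  rw [derivMulti_eq β _ {α} MvPolynomial.support_monomial_subset]
  simp

theorem derivMulti_zero {K : Type*} [CommSemiring K] {r : ℕ}
    (f : MvPolynomial (Fin r) K) : derivMulti 0 f = f := by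
  induction f using MvPolynomial.induction_on' with
  | monomial u a => rw [derivMulti_monomial]; simp
  | add p q hp hq => rw [derivMulti_add, hp, hq]

theorem derivMulti_add_single {K : Type*} [CommSemiring K] {r : ℕ} (β : Fin r →₀ ℕ) (i : Fin r)
    (f : MvPolynomial (Fin r) K) :
    derivMulti (β + Finsupp.single i 1) f = pderiv i (derivMulti β f) := by
  have key : ∀ (α : Fin r →₀ ℕ) (c : K), derivMulti (β + Finsupp.single i 1) (monomial α c) =
      pderiv i (derivMulti β (monomial α c)) := by
    intro α c
    rw [derivMulti_monomial, derivMulti_monomial, pderiv_monomial, tsub_add_eq_tsub_tsub]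
    congr 1
    have : (∏ j : Fin r, (α j).descFactorial ((β + Finsupp.single i 1 : Fin r →₀ ℕ) j)) =
        (∏ j : Fin r, (α j).descFactorial (β j)) * (α i - β i) := by
      rw [← Finset.mul_prod_erase _ _ (Finset.mem_univ i),
        ← Finset.mul_prod_erase (a := i) _ (fun j => (α j).descFactorial (β j)) (Finset.mem_univ i)]
      have h2 : ∀ j ∈ Finset.univ.erase i, (α j).descFactorial ((β + Finsupp.single i 1 : Fin r →₀ ℕ) j) =
          (α j).descFactorial (β j) := by
        intro j hj
        have : i ≠ j := (Finset.ne_of_mem_erase hj).symm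
        simp [this]
      rw [Finset.prod_congr rfl h2]
      simp only [Finsupp.add_apply, Finsupp.single_eq_same, Nat.descFactorial_succ]
      ring
    rw [this]
    simp only [nsmul_eq_mul, Finsupp.coe_tsub, Pi.sub_apply]
    push_cast
    ring
  induction f using MvPolynomial.induction_on' with
  | monomial u a => exact key u a
  | add p q hp hq => rw [derivMulti_add, hp, hq, derivMulti_add, map_add]

theorem contract_eq {K : Type*} [CommSemiring K] {r : ℕ} (D f : MvPolynomial (Fin r) K)
    (s : Finset (Fin r →₀ ℕ)) (hs : D.support ⊆ s) :
    contract D f = ∑ β ∈ s, MvPolynomial.coeff β D • derivMulti β f := by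
  unfold contract
  refine Finset.sum_subset hs fun β _ h => ?_
  rw [MvPolynomial.notMem_support_iff.1 h, zero_smul]

theorem contract_add {K : Type*} [CommSemiring K] {r : ℕ} (D E f : MvPolynomial (Fin r) K) :
    contract (D + E) f = contract D f + contract E f := by
  rw [contract_eq (D + E) f (D.support ∪ E.support) MvPolynomial.support_add,
    contract_eq D f (D.support ∪ E.support) Finset.subset_union_left,
    contract_eq E f (D.support ∪ E.support) Finset.subset_union_right, ← Finset.sum_add_distrib]
  refine Finset.sum_congr rfl fun α _ => ?_
  rw [coeff_add, add_smul]

theorem contract_monomial {K : Type*} [CommSemiring K] {r : ℕ} (β : Fin r →₀ ℕ) (c : K)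
    (f : MvPolynomial (Fin r) K) :
    contract (monomial β c) f = c • derivMulti β f := by
  rw [contract_eq _ f {β} MvPolynomial.support_monomial_subset]
  simp

theorem contract_C {K : Type*} [CommSemiring K] {r : ℕ} (c : K)
    (f : MvPolynomial (Fin r) K) : contract (C c) f = c • f := by
  rw [← monomial_zero', contract_monomial, derivMulti_zero]

theorem contract_mul_X {K : Type*} [CommSemiring K] {r : ℕ} (D f : MvPolynomial (Fin r) K)
    (i : Fin r) : contract (D * X i) f = pderiv i (contract D f) := by
  have key : ∀ (α : Fin r →₀ ℕ) (c : K), contract (monomial α c * X i) f =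
      pderiv i (contract (monomial α c) f) := by
    intro α c
    rw [X, monomial_mul, contract_monomial, contract_monomial, derivMulti_add_single,
      Derivation.map_smul, mul_one]
  induction D using MvPolynomial.induction_on' with
  | monomial u a => exact key u a
  | add p q hp hq => rw [add_mul, contract_add, hp, hq, contract_add, map_add]

/-- `contract D` as a linear map. -/
noncomputable def contractL {K : Type*} [CommSemiring K] {r : ℕ} (D : MvPolynomial (Fin r) K) :
    MvPolynomial (Fin r) K →ₗ[K] MvPolynomial (Fin r) K where
  toFun f := contract D f
  map_add' f g := by
    simp only [contract, derivMulti_add, smul_add, Finset.sum_add_distrib]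
  map_smul' c f := by
    induction D using MvPolynomial.induction_on with
    | C a => simp only [contract_C, RingHom.id_apply]; exact smul_comm _ _ _
    | add p q hp hq => simp only [contract_add, hp, hq, smul_add]
    | mul_X p i hp => simp only [contract_mul_X, hp]; simp

theorem contractL_apply {K : Type*} [CommSemiring K] {r : ℕ} (D f : MvPolynomial (Fin r) K) :
    contractL D f = contract D f := rfl

theorem pderiv_comm' {K : Type*} [CommSemiring K] {r : ℕ} (f : MvPolynomial (Fin r) K)
    (i j : Fin r) : pderiv i (pderiv j f) = pderiv j (pderiv i f) := by
  have h : f = contract (C 1) f := by rw [contract_C, one_smul]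
  rw [h, ← contract_mul_X, ← contract_mul_X, ← contract_mul_X, ← contract_mul_X, mul_assoc,
    mul_comm (X j), mul_assoc]

theorem contract_pderiv {K : Type*} [CommSemiring K] {r : ℕ} (D f : MvPolynomial (Fin r) K)
    (i : Fin r) : contract D (pderiv i f) = pderiv i (contract D f) := by
  induction D using MvPolynomial.induction_on with
  | C a => simp [contract_C]
  | add p q hp hq => simp only [contract_add, hp, hq, map_add]
  | mul_X p j hp => rw [contract_mul_X, contract_mul_X, hp, pderiv_comm']

/-- The operator `Σ_k A_{jk} ∂_k`. -/
noncomputable def rowD {K : Type*} [CommRing K] {r : ℕ} (A : Matrix (Fin r) (Fin r) K)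
    (j : Fin r) (f : MvPolynomial (Fin r) K) : MvPolynomial (Fin r) K :=
  ∑ k, A j k • pderiv k f

theorem contract_X_mul_rowOp {K : Type*} [CommRing K] {r : ℕ} (A : Matrix (Fin r) (Fin r) K)
    (i j : Fin r) (f : MvPolynomial (Fin r) K) :
    contract (X i * rowOp A j) f = rowD A j (pderiv i f) := by
  have hsum : ∀ s : Finset (Fin r), contract (∑ k ∈ s, (A j k • X k * X i)) f =
      ∑ k ∈ s, A j k • pderiv k (pderiv i f) := by
    intro s
    induction s using Finset.induction_on with
    | empty => simp [contract]
    | insert a s ha ih =>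
      rw [Finset.sum_insert ha, Finset.sum_insert ha, contract_add, ih, contract_mul_X,
        smul_eq_C_mul, contract_mul_X, contract_C, pderiv_comm',
        Derivation.map_smul, Derivation.map_smul]
  unfold rowD rowOp
  rw [← hsum, mul_comm, Finset.sum_mul]

theorem mem_Mf_iff {K : Type*} [CommRing K] {r : ℕ} (A : Matrix (Fin r) (Fin r) K)
    (f : MvPolynomial (Fin r) K) :
    A ∈ Mf f ↔ ∀ i j, rowD A j (pderiv i f) - rowD A i (pderiv j f) = 0 := by
  refine forall_congr' fun i => forall_congr' fun j => ?_
  rw [← contract_X_mul_rowOp, ← contract_X_mul_rowOp]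
  have : contract (X i * rowOp A j) f = contract (X i * rowOp A j - X j * rowOp A i) f +
      contract (X j * rowOp A i) f := by
    rw [← contract_add, sub_add_cancel]
  rw [this, add_sub_cancel_right]

theorem rank_map_le {K S L : Type*} [Field K] [CommRing S] [IsDomain S] [Field L] [Algebra K S]
    [Algebra S L] [FaithfulSMul S L] (φ : S →+* K) (hφ : ∀ a, φ (algebraMap K S a) = a)
    {P Q : Type*} [Fintype P] [Fintype Q] (M : Matrix Q P S) :
    (M.map φ).rank ≤ (M.map (algebraMap S L)).rank := by
  obtain ⟨k, hk⟩ : ∃ k, k = (M.map φ).rank := ⟨_, rfl⟩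
  obtain ⟨B, C, hBC⟩ : ∃ (B : Matrix (Fin k) Q K) (C : Matrix P (Fin k) K),
      B * (M.map φ) * C = 1 := by
    let T := (M.map φ).mulVecLin
    have hT : Module.finrank K (LinearMap.range T) = k := hk.symm
    let b : Module.Basis (Fin k) K (LinearMap.range T) := Module.finBasisOfFinrankEq K _ hT
    obtain ⟨p, hp⟩ := LinearMap.exists_leftInverse_of_injective (LinearMap.range T).subtype
      (Submodule.ker_subtype _)
    obtain ⟨s, hs⟩ := LinearMap.exists_rightInverse_of_surjective T.rangeRestrict
      (LinearMap.range_rangeRestrict T)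
    refine ⟨LinearMap.toMatrix' (b.equivFun.toLinearMap ∘ₗ p),
      LinearMap.toMatrix' (s ∘ₗ b.equivFun.symm.toLinearMap), ?_⟩
    have hM : M.map φ = LinearMap.toMatrix' T := (LinearMap.toMatrix'_toLin' _).symm
    rw [hM, ← LinearMap.toMatrix'_comp, ← LinearMap.toMatrix'_comp, ← LinearMap.toMatrix'_id]
    congr 1
    refine LinearMap.ext fun x => ?_
    have h1 := LinearMap.congr_fun hs (b.equivFun.symm x)
    have h2 := LinearMap.congr_fun hp (b.equivFun.symm x)
    have h3 : T (s (b.equivFun.symm x)) = (b.equivFun.symm x : LinearMap.range T) :=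
      congrArg Subtype.val h1
    simp only [LinearMap.comp_apply, LinearEquiv.coe_coe, LinearMap.id_apply] at h2 ⊢
    rw [h3]
    exact (congrArg b.equivFun h2).trans (b.equivFun.apply_symm_apply x)
  have hdet : (B.map (algebraMap K S) * M * C.map (algebraMap K S)).det ≠ 0 := by
    intro h0
    have h1 := congrArg φ h0
    rw [RingHom.map_det, RingHom.mapMatrix_apply, Matrix.map_mul, Matrix.map_mul,
      Matrix.map_map, Matrix.map_map] at h1
    have hid : (φ ∘ algebraMap K S : K → K) = id := funext hφ
    rw [hid, Matrix.map_id, Matrix.map_id, hBC] at h1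
    simp at h1
  have hdet' : ((B.map (algebraMap K S) * M * C.map (algebraMap K S)).map (algebraMap S L)).det
      ≠ 0 := by
    rw [← RingHom.mapMatrix_apply, ← RingHom.map_det]
    intro h
    exact hdet ((FaithfulSMul.algebraMap_injective S L) (h.trans (map_zero _).symm))
  rw [← hk]
  have := Matrix.rank_of_det_ne_zero hdet'
  rw [Fintype.card_fin, Matrix.map_mul, Matrix.map_mul] at this
  rw [← this]
  exact (Matrix.rank_mul_le_left _ _).trans (Matrix.rank_mul_le_right _ _)

theorem finrank_ker_le {K S L : Type*} [Field K] [CommRing S] [IsDomain S] [Field L] [Algebra K S]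
    [Algebra S L] [FaithfulSMul S L] (φ : S →+* K) (hφ : ∀ a, φ (algebraMap K S a) = a)
    {P Q : Type*} [Fintype P] [Fintype Q] (M : Matrix Q P S) :
    Module.finrank L (LinearMap.ker (M.map (algebraMap S L)).mulVecLin) ≤
    Module.finrank K (LinearMap.ker (M.map φ).mulVecLin) := by
  have h := rank_map_le (L := L) φ hφ M
  have h1 := LinearMap.finrank_range_add_finrank_ker (M.map φ).mulVecLin
  have h2 := LinearMap.finrank_range_add_finrank_ker (M.map (algebraMap S L)).mulVecLin
  unfold Matrix.rank at h
  rw [Module.finrank_fintype_fun_eq_card] at h1 h2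
  omega

end Helpers

section Helpers2

open scoped Classical

/-- The coefficient matrix of the linear system defining `Mf f`. -/
noncomputable def sysMat {S : Type*} [CommRing S] {r : ℕ} (f : MvPolynomial (Fin r) S)
    (s : Finset (Fin r →₀ ℕ)) : Matrix (Fin r × Fin r × s) (Fin r × Fin r) S :=
  fun q p => (if p.1 = q.2.1 then coeff q.2.2.1 (pderiv p.2 (pderiv q.1 f)) else 0) -
    (if p.1 = q.1 then coeff q.2.2.1 (pderiv p.2 (pderiv q.2.1 f)) else 0)

theorem sysMat_map {S T : Type*} [CommRing S] [CommRing T] {r : ℕ} (φ : S →+* T)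
    (f : MvPolynomial (Fin r) S) (s : Finset (Fin r →₀ ℕ)) :
    sysMat (map φ f) s = (sysMat f s).map φ := by
  ext q p
  simp only [sysMat, Matrix.map_apply, pderiv_map, coeff_map, map_sub]
  congr 1 <;> split_ifs <;> simp

theorem finrank_Mf {S T : Type*} [CommRing S] [Field T] {r : ℕ} (φ : S →+* T)
    (f : MvPolynomial (Fin r) S) (s : Finset (Fin r →₀ ℕ))
    (hs : ∀ i j, (pderiv i (pderiv j f)).support ⊆ s) :
    Set.finrank T (Mf (map φ f)) =
      Module.finrank T (LinearMap.ker ((sysMat f s).map φ).mulVecLin) := by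
  let e : (Fin r × Fin r → T) ≃ₗ[T] Matrix (Fin r) (Fin r) T := LinearEquiv.curry T T (Fin r) (Fin r)
  have hmem : ∀ v, v ∈ LinearMap.ker ((sysMat f s).map φ).mulVecLin ↔ e v ∈ Mf (map φ f) := by
    intro v
    rw [mem_Mf_iff, LinearMap.mem_ker, ← sysMat_map, funext_iff]
    have hval : ∀ i j (γ : Fin r →₀ ℕ), coeff γ (rowD (e v) j (pderiv i (map φ f)) -
        rowD (e v) i (pderiv j (map φ f))) =
        ∑ k, (v (j, k) * coeff γ (pderiv k (pderiv i (map φ f)))) -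
        ∑ k, (v (i, k) * coeff γ (pderiv k (pderiv j (map φ f)))) := by
      intro i j γ
      simp only [rowD, coeff_sub, coeff_sum, coeff_smul, smul_eq_mul]
      rfl
    have hsys : ∀ q, (sysMat (map φ f) s).mulVecLin v q =
        ∑ k, (v (q.2.1, k) * coeff q.2.2.1 (pderiv k (pderiv q.1 (map φ f)))) -
        ∑ k, (v (q.1, k) * coeff q.2.2.1 (pderiv k (pderiv q.2.1 (map φ f)))) := by
      intro q
      simp only [Matrix.mulVecLin_apply, Matrix.mulVec, dotProduct, sysMat, sub_mul,
        Finset.sum_sub_distrib, Fintype.sum_prod_type, ite_mul, zero_mul]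
      congr 1
      · rw [Finset.sum_comm]; simp [mul_comm]
      · rw [Finset.sum_comm]; simp [mul_comm]
    constructor
    · intro h i j
      ext γ
      rw [coeff_zero]
      by_cases hγ : γ ∈ s
      · rw [hval]
        have := h (i, j, ⟨γ, hγ⟩)
        rw [hsys] at this
        exact this
      · rw [hval]
        have h0 : ∀ i j, coeff γ (pderiv i (pderiv j (map φ f))) = 0 := by
          intro i j
          rw [pderiv_map, pderiv_map, coeff_map, notMem_support_iff.1 (fun hh => hγ (hs i j hh)),
            map_zero]
        simp [h0]
    · intro h q
      rw [hsys, ← hval, h]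
      simp
  have himg : Mf (map φ f) =
      ((LinearMap.ker ((sysMat f s).map φ).mulVecLin).map e.toLinearMap : Set _) := by
    ext A
    constructor
    · intro hA
      refine ⟨e.symm A, (hmem _).2 ?_, ?_⟩
      · rwa [e.apply_symm_apply]
      · exact e.apply_symm_apply A
    · rintro ⟨v, hv, rfl⟩
      exact (hmem v).1 hv
  rw [himg, Set.finrank, Submodule.span_eq]
  exact LinearEquiv.finrank_map_eq e _

theorem part_one {K : Type*} [Field K] {r n : ℕ}
    (ft : MvPolynomial (Fin r) (MvPolynomial (Fin n) K)) :
    Set.finrank (FractionRing (MvPolynomial (Fin n) K))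
        (Mf (MvPolynomial.map (algebraMap (MvPolynomial (Fin n) K)
          (FractionRing (MvPolynomial (Fin n) K))) ft)) ≤
      Set.finrank K (Mf (MvPolynomial.map (MvPolynomial.eval (0 : Fin n → K)) ft)) := by
  let s : Finset (Fin r →₀ ℕ) :=
    Finset.univ.biUnion fun i => Finset.univ.biUnion fun j => (pderiv i (pderiv j ft)).support
  have hs : ∀ i j, (pderiv i (pderiv j ft)).support ⊆ s := by
    intro i j x hx
    simp only [s, Finset.mem_biUnion, Finset.mem_univ, true_and]
    exact ⟨i, j, hx⟩
  rw [finrank_Mf _ ft s hs, finrank_Mf _ ft s hs]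
  exact finrank_ker_le _ (fun a => by simp [algebraMap_eq]) _

theorem eq_zero_of_pderiv {K : Type*} [Field K] [CharZero K] {r d : ℕ}
    {h : MvPolynomial (Fin r) K} (hh : h.IsHomogeneous d) (hd : d ≠ 0)
    (h0 : ∀ i, pderiv i h = 0) : h = 0 := by
  have := hh.sum_X_mul_pderiv
  simp only [h0, mul_zero, Finset.sum_const_zero] at this
  rcases smul_eq_zero.1 this.symm with h | h
  · exact absurd h hd
  · exact h

theorem eq_zero_of_contract {K : Type*} [Field K] [CharZero K] {r : ℕ} (d : ℕ) :
    ∀ {h : MvPolynomial (Fin r) K}, h.IsHomogeneous d →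
    (∀ D : MvPolynomial (Fin r) K, D.IsHomogeneous d → contract D h = 0) → h = 0 := by
  induction d with
  | zero =>
    intro h _ h0
    have := h0 (C 1) (isHomogeneous_C _ _)
    rwa [contract_C, one_smul] at this
  | succ d ih =>
    intro h hh h0
    refine eq_zero_of_pderiv hh d.succ_ne_zero fun i => ih hh.pderiv fun D hD => ?_
    rw [contract_pderiv, ← contract_mul_X]
    exact h0 _ (hD.mul (isHomogeneous_X _ _))

theorem contract_homogeneous {K : Type*} [Field K] {r : ℕ} {a b : ℕ}
    {D h : MvPolynomial (Fin r) K} (hD : D.IsHomogeneous a) (hh : h.IsHomogeneous (a + b)) :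
    (contract D h).IsHomogeneous b := by
  have key : ∀ (a : ℕ) (β : Fin r →₀ ℕ), β.degree = a → ∀ b, ∀ h : MvPolynomial (Fin r) K,
      h.IsHomogeneous (a + b) → (derivMulti β h).IsHomogeneous b := by
    intro a
    induction a with
    | zero =>
      intro β hβ b h hh
      rw [Finsupp.degree_eq_zero_iff] at hβ
      rw [hβ, derivMulti_zero]
      rwa [zero_add] at hh
    | succ a ih =>
      intro β hβ b h hh
      obtain ⟨i, hi⟩ : ∃ i, β i ≠ 0 := by
        by_contra! hc
        have : β = 0 := Finsupp.ext hc
        simp [this] at hβ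
      have hβ' : β = (β - Finsupp.single i 1) + Finsupp.single i 1 := by
        rw [tsub_add_cancel_of_le]
        rw [Finsupp.single_le_iff]
        omega
      rw [hβ', derivMulti_add_single]
      have : (b + 1) - 1 = b := rfl
      rw [← this]
      refine IsHomogeneous.pderiv (ih _ ?_ _ _ ?_)
      · rw [hβ', map_add, Finsupp.degree_single] at hβ
        omega
      · rwa [show a + (b + 1) = a + 1 + b by ring]
  unfold contract
  refine IsHomogeneous.sum _ _ _ fun β hβ => ?_
  rw [smul_eq_C_mul]
  refine IsHomogeneous.C_mul (key a β ?_ b h hh) _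
  have := hD (mem_support_iff.1 hβ)
  rwa [Finsupp.degree_eq_weight_one]

theorem exists_proj {K V : Type*} [Field K] [AddCommGroup V] [Module K V] (p q : Submodule K V)
    (h : Disjoint p q) : ∃ P : V →ₗ[K] V, (∀ v ∈ p, P v = v) ∧ ∀ v ∈ q, P v = 0 := by
  obtain ⟨g, hg⟩ := LinearMap.exists_leftInverse_of_injective (q.mkQ ∘ₗ p.subtype) (by
    rw [LinearMap.ker_eq_bot']
    intro m hm
    have hq : (m : V) ∈ q := by simpa using hm
    exact Subtype.ext (Submodule.disjoint_def.1 h _ m.2 hq))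
  refine ⟨p.subtype ∘ₗ g ∘ₗ q.mkQ, fun v hv => ?_, fun v hv => ?_⟩
  · exact congrArg Subtype.val (LinearMap.congr_fun hg ⟨v, hv⟩)
  · have : q.mkQ v = 0 := by simpa using hv
    rw [LinearMap.comp_apply, LinearMap.comp_apply, this, map_zero, map_zero]

theorem linear_form {K : Type*} [Field K] {r : ℕ} {v : MvPolynomial (Fin r) K}
    (hv : v.IsHomogeneous 1) (j : Fin r) :
    pderiv j v = C (coeff (Finsupp.single j 1) v) := by
  have h0 : (pderiv j v).IsHomogeneous 0 := hv.pderiv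
  rw [totalDegree_eq_zero_iff_eq_C.1 (Nat.le_zero.1 h0.totalDegree_le), coeff_pderiv]
  simp

theorem rowD_linear {K : Type*} [Field K] {r : ℕ} {v : MvPolynomial (Fin r) K}
    (hv : v.IsHomogeneous 1) (P : MvPolynomial (Fin r) K →ₗ[K] MvPolynomial (Fin r) K)
    (A : Matrix (Fin r) (Fin r) K) (hA : ∀ j k, A j k = coeff (Finsupp.single j 1) (P (X k)))
    (j : Fin r) : rowD A j v = C (coeff (Finsupp.single j 1) (P v)) := by
  have hX : v = ∑ k, coeff (Finsupp.single k 1) v • X k := by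
    have := hv.sum_X_mul_pderiv
    rw [one_smul] at this
    conv_lhs => rw [← this]
    refine Finset.sum_congr rfl fun k _ => ?_
    rw [linear_form hv, mul_comm, smul_eq_C_mul]
  have hP : P v = ∑ k, coeff (Finsupp.single k 1) v • P (X k) := by
    conv_lhs => rw [hX]
    simp only [map_sum, map_smul]
  rw [hP, coeff_sum, map_sum, rowD]
  refine Finset.sum_congr rfl fun k _ => ?_
  rw [linear_form hv, hA, coeff_smul, smul_eq_C_mul, smul_eq_mul, C_mul, mul_comm]

end Helpers2

section Helpers3

open scoped Classical

theorem part_two {L : Type*} [Field L] [CharZero L] {r d : ℕ} (hd : d ≠ 0)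
    (f : MvPolynomial (Fin r) L) (G : Set (MvPolynomial (Fin r) L)) (hG : IsRegSplit d f G) :
    G.ncard ≤ Set.finrank L (Mf f) := by
  obtain ⟨hfin, -, hhom, hsum, hdis⟩ := hG
  have hd1 : d - 1 + 1 = d := Nat.succ_pred_eq_of_ne_zero hd
  have hmemP : ∀ (g : MvPolynomial (Fin r) L) (D : MvPolynomial (Fin r) L),
      D.IsHomogeneous (d - 1) → contract D g ∈ partials (d - 1) g :=
    fun g D hD => Submodule.subset_span ⟨D, hD, rfl⟩
  have hlin : ∀ g ∈ G, ∀ D : MvPolynomial (Fin r) L, D.IsHomogeneous (d - 1) →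
      (contract D g).IsHomogeneous 1 := by
    intro g hg D hD
    refine contract_homogeneous hD ?_
    rw [hd1]
    exact (hhom g hg).2
  have hA : ∀ g : G, ∃ A : Matrix (Fin r) (Fin r) L, ∀ j, rowD A j f = pderiv j g.1 := by
    rintro ⟨g, hg⟩
    obtain ⟨P, hP1, hP0⟩ := exists_proj _ _ (hdis g hg)
    refine ⟨fun j k => coeff (Finsupp.single j 1) (P (X k)), fun j => ?_⟩
    set A : Matrix (Fin r) (Fin r) L := fun j k => coeff (Finsupp.single j 1) (P (X k)) with hAdef
    have hrow_hom : ∀ h ∈ G, (rowD A j h).IsHomogeneous (d - 1) := by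
      intro h hh
      refine IsHomogeneous.sum _ _ _ fun k _ => ?_
      rw [smul_eq_C_mul]
      exact ((hhom h hh).2.pderiv).C_mul _
    have hcomm : ∀ D h, contract D (rowD A j h) = rowD A j (contract D h) := by
      intro D h
      rw [← contractL_apply, rowD, map_sum, rowD]
      refine Finset.sum_congr rfl fun k _ => ?_
      rw [map_smul, contractL_apply, contract_pderiv]
    have hself : rowD A j g = pderiv j g := by
      rw [← sub_eq_zero]
      refine eq_zero_of_contract (d - 1) ((hrow_hom g hg).sub (hhom g hg).2.pderiv) fun D hD => ?_
      rw [← contractL_apply, map_sub, contractL_apply, contractL_apply, hcomm, contract_pderiv,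
        rowD_linear (hlin g hg D hD) P A (fun _ _ => rfl), hP1 _ (hmemP g D hD),
        linear_form (hlin g hg D hD), sub_self]
    have hother : ∀ h ∈ G, h ≠ g → rowD A j h = 0 := by
      intro h hh hne
      refine eq_zero_of_contract (d - 1) (hrow_hom h hh) fun D hD => ?_
      have hm : contract D h ∈ ⨆ h ∈ G \ {g}, partials (d - 1) h :=
        (le_iSup₂_of_le (f := fun h (_ : h ∈ G \ {g}) => partials (d - 1) h) h ⟨hh, hne⟩ le_rfl)
          (hmemP h D hD)
      rw [hcomm, rowD_linear (hlin h hh D hD) P A (fun _ _ => rfl), hP0 _ hm]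
      simp
    have hrsum : ∀ s : Finset (MvPolynomial (Fin r) L),
        rowD A j (∑ h ∈ s, h) = ∑ h ∈ s, rowD A j h := by
      intro s
      simp only [rowD, map_sum, Finset.smul_sum]
      exact Finset.sum_comm
    rw [← hsum, finsum_mem_eq_finite_toFinset_sum _ hfin, hrsum,
      Finset.sum_eq_single_of_mem g (hfin.mem_toFinset.2 hg), hself]
    intro h hh hne
    exact hother h (hfin.mem_toFinset.1 hh) hne
  choose A hA using hA
  have hmem : ∀ g, A g ∈ Mf f := by
    intro g
    rw [mem_Mf_iff]
    have hp : ∀ i j, rowD (A g) j (pderiv i f) = pderiv i (rowD (A g) j f) := by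
      intro i j
      simp only [rowD, map_sum, Derivation.map_smul]
      refine Finset.sum_congr rfl fun k _ => ?_
      rw [pderiv_comm']
    intro i j
    rw [hp, hp, hA, hA, pderiv_comm', sub_self]
  have : Fintype G := hfin.fintype
  have hli : LinearIndependent L A := by
    rw [Fintype.linearIndependent_iff]
    intro c hc g0
    have hgrad : ∑ g, c g • g.1 = 0 := by
      refine eq_zero_of_pderiv (d := d) ?_ hd fun j => ?_
      · refine IsHomogeneous.sum _ _ _ fun g _ => ?_
        rw [smul_eq_C_mul]
        exact (hhom g.1 g.2).2.C_mul _
      · have h1 : rowD (∑ g, c g • A g) j f = ∑ g, c g • rowD (A g) j f := by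
          simp only [rowD, Matrix.sum_apply, Matrix.smul_apply, Finset.sum_smul, Finset.smul_sum,
            smul_assoc]
          exact Finset.sum_comm
        rw [hc] at h1
        simp only [hA] at h1
        simp only [map_sum, Derivation.map_smul]
        rw [← h1]
        simp [rowD]
    have hz : c g0 • g0.1 = 0 := by
      refine eq_zero_of_contract (d - 1 + 1) ?_ ?_
      · rw [hd1, smul_eq_C_mul]
        exact (hhom g0.1 g0.2).2.C_mul _
      · have : ∀ D : MvPolynomial (Fin r) L, D.IsHomogeneous (d - 1) →
            contract D (c g0 • g0.1) = 0 := by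
          intro D hD
          have h2 := congrArg (contractL D) hgrad
          rw [map_zero, ← Finset.add_sum_erase _ _ (Finset.mem_univ g0), map_add, map_sum] at h2
          refine Submodule.disjoint_def.1 (hdis g0.1 g0.2) _ ?_ ?_
          · rw [← contractL_apply, map_smul]
            exact Submodule.smul_mem _ _ (hmemP _ D hD)
          · rw [← contractL_apply, eq_neg_of_add_eq_zero_left h2]
            refine Submodule.neg_mem _ (Submodule.sum_mem _ fun g hg => ?_)
            rw [map_smul]
            refine Submodule.smul_mem _ _ ?_
            have hne : g.1 ≠ g0.1 := fun h => Finset.ne_of_mem_erase hg (Subtype.ext h)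
            exact (le_iSup₂_of_le (f := fun h (_ : h ∈ G \ {g0.1}) => partials (d - 1) h) g.1
              ⟨g.2, hne⟩ le_rfl) (hmemP g.1 D hD)
        have hpd : ∀ i, pderiv i (c g0 • g0.1) = 0 := by
          intro i
          refine eq_zero_of_contract (d - 1) ?_ fun D hD => ?_
          · rw [smul_eq_C_mul]
            exact ((hhom g0.1 g0.2).2.C_mul _).pderiv
          · rw [contract_pderiv, this D hD, map_zero]
        intro D _
        have : c g0 • g0.1 = 0 := by
          refine eq_zero_of_pderiv (d := d) ?_ hd hpd
          rw [smul_eq_C_mul]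
          exact (hhom g0.1 g0.2).2.C_mul _
        rw [this, ← contractL_apply, map_zero]
    rcases smul_eq_zero.1 hz with h | h
    · exact h
    · exact absurd h (hhom g0.1 g0.2).1
  let B : G → Submodule.span L (Mf f) := fun g => ⟨A g, Submodule.subset_span (hmem g)⟩
  have hB : LinearIndependent L B := LinearIndependent.of_comp (Submodule.subtype _) hli
  have := hB.fintype_card_le_finrank
  rwa [← Nat.card_eq_fintype_card, Nat.card_coe_set_eq] at this

theorem part_two_zero {L : Type*} [Field L] {r : ℕ}
    (f : MvPolynomial (Fin r) L) (G : Set (MvPolynomial (Fin r) L)) (hG : IsRegSplit 0 f G) :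
    G.ncard ≤ 1 := by
  obtain ⟨hfin, -, hhom, hsum, hdis⟩ := hG
  rw [Set.ncard_le_one hfin]
  intro g hg h hh
  by_contra hne
  have hself : ∀ g : MvPolynomial (Fin r) L, g ∈ partials (0 - 1) g := fun g =>
    Submodule.subset_span ⟨C 1, isHomogeneous_C _ _, by rw [contract_C, one_smul]⟩
  have hC : ∀ g ∈ G, ∃ a, g = C a := fun g hg =>
    ⟨_, totalDegree_eq_zero_iff_eq_C.1 (Nat.le_zero.1 (hhom g hg).2.totalDegree_le)⟩
  obtain ⟨a, rfl⟩ := hC g hg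
  obtain ⟨b, rfl⟩ := hC h hh
  have hb : b ≠ 0 := fun h0 => (hhom _ hh).1 (by rw [h0, map_zero])
  refine (hhom _ hg).1 (Submodule.disjoint_def.1 (hdis _ hg) _ (hself _) ?_)
  have : (C a : MvPolynomial (Fin r) L) = (a / b) • C b := by
    rw [smul_eq_C_mul, ← C_mul, div_mul_cancel₀ _ hb]
  have hm := Submodule.smul_mem _ (a / b) (hself (C b))
  rw [← this] at hm
  exact (le_iSup₂_of_le (f := fun h (_ : h ∈ G \ {C a}) => partials (0 - 1) h) (C b)
    ⟨hh, fun h => hne h.symm⟩ le_rfl) hm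

end Helpers3

/-- Lemma 4.3. For `f_t ∈ ℛ_d ⊗_K K[t_1,…,t_n]`,
`dim_{K(t)} M_{f_t} ≤ dim_K M_{f_0}`; in particular if `f_t` splits regularly `m` times
over `K(t_1,…,t_n)` then `m ≤ dim_K M_{f_0} − 1`. -/
theorem dim_Mf_specialization {K : Type*} [Field K] [CharZero K] {r d n : ℕ}
    (ft : MvPolynomial (Fin r) (MvPolynomial (Fin n) K)) (hft : ft.IsHomogeneous d) :
    Set.finrank (FractionRing (MvPolynomial (Fin n) K))
        (Mf (MvPolynomial.map (algebraMap (MvPolynomial (Fin n) K)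
          (FractionRing (MvPolynomial (Fin n) K))) ft)) ≤
      Set.finrank K (Mf (MvPolynomial.map (MvPolynomial.eval (0 : Fin n → K)) ft)) ∧
    ∀ m : ℕ, ∀ G : Set (MvPolynomial (Fin r) (FractionRing (MvPolynomial (Fin n) K))),
      IsRegSplit d (MvPolynomial.map (algebraMap (MvPolynomial (Fin n) K)
        (FractionRing (MvPolynomial (Fin n) K))) ft) G → G.ncard = m + 1 →
      m ≤ Set.finrank K (Mf (MvPolynomial.map (MvPolynomial.eval (0 : Fin n → K)) ft)) - 1 := by
  refine ⟨part_one ft, fun m G hG hm => ?_⟩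
  rcases Nat.eq_zero_or_pos d with rfl | hd
  · have := part_two_zero _ G hG
    omega
  · have h1 := part_two hd.ne' _ G hG
    have h2 := part_one ft
    omega

end Kleppe
end
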